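/- Let L be a finite field, K̃ ⊆ L a subfield, n ≥ 2 an even integer, G a group, and ρ: G → GSp_n(L) a homomorphism that is absolutely irreducible (as a representation into GL_n(L)) and has no complex multiplication. Assume that Tr(ρ(g)) ∈ K̃ and that the multiplier m(ρ(g)) ∈ K̃ for all g ∈ G. Then there exists M ∈ GSp_n(L) such that M⁻¹ ρ(g) M ∈ GSp_n(K̃) for all g ∈ G; i.e. the symplectic equivalence class of ρ has a representative with values in GSp_n(K̃). -/

import Mathlib

open Matrix

noncomputable section

/-- The Gram matrix of the standard symplectic form on `R^n` (for `n` even):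
block form `[[0, I], [-I, 0]]`. -/
def stdJ (n : ℕ) (R : Type*) [CommRing R] : Matrix (Fin n) (Fin n) R :=
  Matrix.of fun i j =>
    if i.val + n / 2 = j.val then 1 else if j.val + n / 2 = i.val then -1 else 0

/-- Membership in the general symplectic group `GSp_n(R)`. -/
def IsGSp (n : ℕ) (R : Type*) [CommRing R] (M : Matrix (Fin n) (Fin n) R) : Prop :=
  IsUnit M ∧ ∃ α : Rˣ, Mᵀ * stdJ n R * M = (α : R) • stdJ n R

/-- Symplectic equivalence: `ρ' = M ρ M⁻¹` for some `M ∈ GSp_n(L)`. -/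
def SympEquiv {G : Type*} (n : ℕ) (L : Type*) [Field L]
    (ρ ρ' : G → Matrix (Fin n) (Fin n) L) : Prop :=
  ∃ M : Matrix (Fin n) (Fin n) L, IsGSp n L M ∧ ∀ g, ρ' g = M * ρ g * M⁻¹

/-- Absolute irreducibility: the induced representation on `L̄^n` is irreducible. -/
def MatAbsIrred {G : Type*} (n : ℕ) (L : Type*) [Field L]
    (ρ : G → Matrix (Fin n) (Fin n) L) : Prop :=
  ∀ W : Submodule (AlgebraicClosure L) (Fin n → AlgebraicClosure L),
    (∀ g, ∀ w ∈ W, ((ρ g).map (algebraMap L (AlgebraicClosure L))).mulVec w ∈ W) →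
    W = ⊥ ∨ W = ⊤

/-- `ρ` has no complex multiplication. -/
def NoCM {G : Type*} [Group G] (n : ℕ) (L : Type*) [Field L]
    (ρ : G →* Matrix (Fin n) (Fin n) L) : Prop :=
  ∀ ε : G →* Lˣ, SympEquiv n L (fun g => (ε g : L) • ρ g) (fun g => ρ g) → ε = 1

/-- **Burnside's theorem** on matrix algebras. -/
theorem Subalgebra.eq_top_of_irreducible {F V : Type*} [Field F] [IsAlgClosed F]
    [AddCommGroup V] [Module F V] [FiniteDimensional F V] [Nontrivial V]
    (S : Subalgebra F (Module.End F V))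
    (h : ∀ W : Submodule F V, (∀ s ∈ S, ∀ w ∈ W, s w ∈ W) → W = ⊥ ∨ W = ⊤) : S = ⊤ := by
  have hsimple : IsSimpleModule S V := by
    rw [isSimpleModule_iff]
    refine { exists_pair_ne := ⟨⊥, ⊤, bot_ne_top⟩, eq_bot_or_eq_top := fun W => ?_ }
    rcases h (W.restrictScalars F) (fun s hs w hw => W.smul_mem ⟨s, hs⟩ hw) with hW | hW
    · left; simpa using hW
    · right; simpa using hW
  have hschur := (IsSimpleModule.algebraMap_end_bijective_of_isAlgClosed (A := S) (V := V) F).2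
  have hfin : Module.Finite (Module.End S V) V := by
    obtain ⟨s, hs⟩ := Module.Finite.fg_top (R := F) (M := V)
    refine ⟨s, eq_top_iff.2 fun v _ => ?_⟩
    have hv : v ∈ Submodule.span F (s : Set V) := hs ▸ trivial
    induction hv using Submodule.span_induction with
    | mem x hx => exact Submodule.subset_span hx
    | zero => exact zero_mem _
    | add x y _ _ hx hy => exact add_mem (hx trivial) (hy trivial)
    | smul a x _ hx => exact Submodule.smul_mem _ (algebraMap F (Module.End S V) a) (hx trivial)
  rw [eq_top_iff]
  intro f _
  let f' : Module.End (Module.End S V) V :=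
    { toFun := f
      map_add' := f.map_add
      map_smul' := fun c v => by
        obtain ⟨a, rfl⟩ := hschur c
        exact f.map_smul a v }
  obtain ⟨r, hr⟩ := Module.Finite.toModuleEnd_moduleEnd_surjective (R := S) (M := V) f'
  have : (r : Module.End F V) = f := by
    ext v
    exact congr($hr v)
  exact this ▸ r.2

theorem Matrix.mem_range_scalar_of_commute_of_span_eq_top {n R : Type*} [Fintype n]
    [DecidableEq n] [CommRing R] {s : Set (Matrix n n R)} (hs : Submodule.span R s = ⊤)
    {X : Matrix n n R} (hX : ∀ a ∈ s, Commute a X) : ∃ c : R, X = c • 1 := by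
  have hall : ∀ Y, Commute Y X := fun Y => by
    have hY : Y ∈ Submodule.span R s := hs ▸ trivial
    induction hY using Submodule.span_induction with
    | mem x hx => exact hX x hx
    | zero => exact Commute.zero_left _
    | add x y _ _ hx hy => exact hx.add_left hy
    | smul a x _ hx => exact hx.smul_left a
  obtain ⟨c, hc⟩ := Matrix.mem_range_scalar_of_commute_single (M := X) fun i j _ => hall _
  exact ⟨c, by rw [← hc, Matrix.scalar_apply, Matrix.smul_one_eq_diagonal]⟩

theorem Matrix.exists_trace_mul_ne_zero {n R : Type*} [Fintype n]
    [CommRing R] {s : Set (Matrix n n R)} (hs : Submodule.span R s = ⊤)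
    {X : Matrix n n R} (hX : X ≠ 0) : ∃ a ∈ s, (X * a).trace ≠ 0 := by
  by_contra! h
  refine hX (Matrix.ext_iff_trace_mul_right.2 fun Y => ?_)
  have hY : Y ∈ Submodule.span R s := hs ▸ trivial
  rw [Matrix.zero_mul, Matrix.trace_zero]
  induction hY using Submodule.span_induction with
  | mem x hx => exact h x hx
  | zero => simp
  | add x y _ _ hx hy => rw [Matrix.mul_add, Matrix.trace_add, hx, hy, add_zero]
  | smul a x _ hx => rw [Matrix.mul_smul, Matrix.trace_smul, hx, smul_zero]

/-- An algebra homomorphism from a matrix algebra over a subfield to the matrix algebra of the same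
size is inner. -/
theorem Matrix.exists_isUnit_intertwining {n K L : Type*} [Fintype n] [DecidableEq n] [Nonempty n]
    [Field K] [Field L] [Algebra K L] (φ : Matrix n n K →ₐ[K] Matrix n n L) :
    ∃ M : Matrix n n L, IsUnit M ∧ ∀ X, φ X * M = M * X.map (algebraMap K L) := by
  obtain ⟨o⟩ := ‹Nonempty n›
  have hinj : Function.Injective φ := φ.toRingHom.injective
  have he : φ (single o o 1) ≠ 0 := by
    rw [Ne, map_eq_zero_iff φ hinj]
    intro h
    simpa using congr_fun₂ h o o
  obtain ⟨u, hu⟩ : ∃ u, φ (single o o 1) *ᵥ u ≠ 0 := by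
    by_contra! h
    exact he (Matrix.ext_of_mulVec_single fun i => by rw [h, Matrix.zero_mulVec])
  set v := φ (single o o 1) *ᵥ u with hv
  let m : n → n → L := fun i => φ (single i o 1) *ᵥ v
  have hm : ∀ X j, φ X *ᵥ m j = ∑ i, algebraMap K L (X i j) • m i := fun X j => by
    have hX : X * single j o 1 = ∑ i, X i j • single i o (1 : K) := by
      ext a b
      simp [Matrix.mul_apply, Matrix.sum_apply, Matrix.single_apply, ite_and]
    simp only [m]
    rw [Matrix.mulVec_mulVec, ← map_mul, hX, map_sum, Matrix.sum_mulVec]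
    exact Finset.sum_congr rfl fun i _ => by
      rw [map_smul, Matrix.smul_mulVec, algebraMap_smul]
  have hmo : ∀ i j k, φ (single i j 1) *ᵥ m k = if j = k then m i else 0 := fun i j k => by
    rw [hm]
    simp [Matrix.single_apply, ite_and]
  have hoo : m o = v := by
    simp only [m]
    rw [hv, Matrix.mulVec_mulVec, ← map_mul]
    simp
  have hli : LinearIndependent L m := by
    rw [Fintype.linearIndependent_iff]
    intro g hg i
    have h1 : φ (single o i 1) *ᵥ (∑ k, g k • m k) = g i • m o := by
      simp [Matrix.mulVec_sum, Matrix.mulVec_smul, hmo]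
    rw [hg, Matrix.mulVec_zero, hoo] at h1
    exact (smul_eq_zero.1 h1.symm).resolve_right hu
  refine ⟨(Matrix.of m)ᵀ, ?_, fun X => ?_⟩
  · rw [Matrix.isUnit_transpose]
    exact Matrix.linearIndependent_rows_iff_isUnit.1 hli
  · ext a j
    have := congr_fun (hm X j) a
    simpa only [Matrix.mul_apply, Matrix.mulVec, dotProduct, Finset.sum_apply, Pi.smul_apply,
      smul_eq_mul, Matrix.transpose_apply, Matrix.of_apply, Matrix.map_apply, mul_comm] using this

theorem Submodule.finrank_le_finrank_of_span_eq_top {K L V : Type*} [Field K] [Field L]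
    [Algebra K L] [AddCommGroup V] [Module L V] [Module K V] [IsScalarTower K L V]
    (W : Submodule K V) [FiniteDimensional K W] (hW : Submodule.span L (W : Set V) = ⊤) :
    Module.finrank L V ≤ Module.finrank K W := by
  let b := Module.finBasis K W
  have hb : Submodule.span L (Set.range fun i => (b i : V)) = ⊤ := by
    rw [eq_top_iff, ← hW, Submodule.span_le]
    intro w hw
    have := congrArg Subtype.val (b.sum_repr ⟨w, hw⟩)
    rw [← show _ = w from this]
    rw [Submodule.coe_sum]
    refine Submodule.sum_mem _ fun i _ => ?_
    rw [Submodule.coe_smul, ← algebraMap_smul L]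
    exact Submodule.smul_mem _ _ (Submodule.subset_span ⟨i, rfl⟩)
  have := finrank_range_le_card (R := L) (fun i => (b i : V))
  rwa [Set.finrank, hb, finrank_top, Fintype.card_fin] at this

section Descent

variable {K L n : Type*} [Field K] [Field L] [Algebra K L] [Fintype n] [DecidableEq n]

/-- A `K`-subalgebra of a matrix algebra over `L` which spans it over `L` and has `K`-valued
traces has dimension at most that of the whole algebra over `L`. -/
theorem Matrix.finrank_le_of_trace_mem [FiniteDimensional K L]
    (A : Subalgebra K (Matrix n n L)) (hspan : Submodule.span L (A : Set (Matrix n n L)) = ⊤)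
    (htr : ∀ a ∈ A, a.trace ∈ (algebraMap K L).range) :
    Module.finrank K A ≤ Fintype.card n * Fintype.card n := by
  obtain ⟨s, hsA, hsspan, hsli⟩ := exists_linearIndependent L (A : Set (Matrix n n L))
  have : Fintype s := hsli.setFinite.fintype
  have hcard : Fintype.card s ≤ Fintype.card n * Fintype.card n := by
    have := hsli.fintype_card_le_finrank
    simpa [Module.finrank_matrix] using this
  let T : A →ₗ[K] (s → L) := LinearMap.pi fun a =>
    { toFun := fun x => ((x : Matrix n n L) * a).trace
      map_add' := fun x y => by simp [Matrix.add_mul]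
      map_smul' := fun c x => by simp }
  have hT : Function.Injective T := by
    rw [← LinearMap.ker_eq_bot, LinearMap.ker_eq_bot']
    intro x hx
    by_contra hx0
    obtain ⟨a, ha, hxa⟩ := Matrix.exists_trace_mul_ne_zero (hsspan.trans hspan)
      (X := (x : Matrix n n L)) (by simpa using hx0)
    exact hxa (congr_fun hx ⟨a, ha⟩)
  let ι : (s → K) →ₗ[K] (s → L) := (Algebra.linearMap K L).compLeft s
  have hle : T.range ≤ ι.range := by
    rintro _ ⟨x, rfl⟩
    choose c hc using fun a : s => htr _ (A.mul_mem x.2 (hsA a.2))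
    exact ⟨c, funext hc⟩
  calc Module.finrank K A = Module.finrank K T.range := (LinearMap.finrank_range_of_inj hT).symm
    _ ≤ Module.finrank K ι.range := Submodule.finrank_mono hle
    _ ≤ Module.finrank K (s → K) := ι.finrank_range_le
    _ ≤ _ := by simpa using hcard

/-- A scalar matrix in such a subalgebra has its entry in the small field. -/
theorem Matrix.mem_range_of_smul_one_mem [Nonempty n]
    (A : Subalgebra K (Matrix n n L)) (hspan : Submodule.span L (A : Set (Matrix n n L)) = ⊤)
    (htr : ∀ a ∈ A, a.trace ∈ (algebraMap K L).range) {c : L}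
    (hc : c • (1 : Matrix n n L) ∈ A) : c ∈ (algebraMap K L).range := by
  obtain ⟨a, ha, h⟩ := Matrix.exists_trace_mul_ne_zero hspan (one_ne_zero (α := Matrix n n L))
  rw [one_mul] at h
  obtain ⟨x, hx⟩ := htr a ha
  obtain ⟨y, hy⟩ := htr _ (A.mul_mem hc ha)
  rw [smul_mul_assoc, one_mul, Matrix.trace_smul, smul_eq_mul, ← hx] at hy
  exact ⟨y / x, by rw [map_div₀, hy, mul_div_cancel_right₀ _ (hx ▸ h)]⟩

theorem Matrix.isSimpleRing_of_trace_mem [FiniteDimensional K L] [Nonempty n]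
    (A : Subalgebra K (Matrix n n L)) (hspan : Submodule.span L (A : Set (Matrix n n L)) = ⊤)
    (htr : ∀ a ∈ A, a.trace ∈ (algebraMap K L).range) : IsSimpleRing A := by
  rw [isSimpleRing_iff_isTwoSided_imp]
  refine ⟨inferInstance, fun I hI => or_iff_not_imp_left.2 fun hI0 => ?_⟩
  obtain ⟨x, hxI, hx0⟩ := I.ne_bot_iff.1 hI0
  let W : Submodule K (Matrix n n L) := (I.restrictScalars K).map A.val.toLinearMap
  have hmul : ∀ Y Z : Matrix n n L, Y * x * Z ∈ Submodule.span L (W : Set (Matrix n n L)) := by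
    intro Y Z
    have hY : Y ∈ Submodule.span L (A : Set (Matrix n n L)) := hspan ▸ trivial
    have hZ : Z ∈ Submodule.span L (A : Set (Matrix n n L)) := hspan ▸ trivial
    induction hY using Submodule.span_induction with
    | zero => simp
    | add _ _ _ _ h₁ h₂ => rw [add_mul, add_mul]; exact add_mem h₁ h₂
    | smul a _ _ h => rw [smul_mul_assoc, smul_mul_assoc]; exact Submodule.smul_mem _ _ h
    | mem Y hY =>
      induction hZ using Submodule.span_induction with
      | zero => simp
      | add _ _ _ _ h₁ h₂ => rw [mul_add]; exact add_mem h₁ h₂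
      | smul a _ _ h => rw [mul_smul_comm]; exact Submodule.smul_mem _ _ h
      | mem Z hZ =>
        exact Submodule.subset_span ⟨⟨Y, hY⟩ * x * ⟨Z, hZ⟩,
          I.mul_mem_right _ (I.mul_mem_left _ hxI), rfl⟩
  have hW : Submodule.span L (W : Set (Matrix n n L)) = ⊤ := by
    obtain ⟨i, j, hij⟩ : ∃ i j, (x : Matrix n n L) i j ≠ 0 := by
      by_contra! h
      exact hx0 (Subtype.ext (Matrix.ext h))
    rw [eq_top_iff]
    intro Y _
    rw [Matrix.matrix_eq_sum_single Y]
    refine Submodule.sum_mem _ fun a _ => Submodule.sum_mem _ fun b _ => ?_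
    convert! hmul (single a i (Y a b)) (single j b ((x : Matrix n n L) i j)⁻¹) using 1
    rw [Matrix.single_mul_mul_single]
    simp [hij]
  have h1 := W.finrank_le_finrank_of_span_eq_top (L := L) hW
  have h2 := Matrix.finrank_le_of_trace_mem A hspan htr
  have h3 : W = Subalgebra.toSubmodule A := by
    refine Submodule.eq_of_le_of_finrank_le ?_ ?_
    · rintro _ ⟨y, _, rfl⟩
      exact y.2
    · refine h2.trans (le_trans ?_ h1)
      simp [Module.finrank_matrix]
  rw [Ideal.eq_top_iff_one]
  obtain ⟨y, hy, hy1⟩ : (1 : Matrix n n L) ∈ W := h3 ▸ A.one_mem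
  rwa [show y = 1 from Subtype.ext hy1] at hy

theorem Matrix.exists_algEquiv_of_trace_mem [Finite L] [Nonempty n]
    (A : Subalgebra K (Matrix n n L)) (hspan : Submodule.span L (A : Set (Matrix n n L)) = ⊤)
    (htr : ∀ a ∈ A, a.trace ∈ (algebraMap K L).range) : Nonempty (Matrix n n K ≃ₐ[K] A) := by
  have : Finite K := Finite.of_injective _ (algebraMap K L).injective
  have : FiniteDimensional K L := Module.Finite.of_finite
  have := Matrix.isSimpleRing_of_trace_mem A hspan htr
  have : IsArtinianRing A := IsArtinianRing.of_finite K A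
  obtain ⟨r, _, D, _, _, _, ⟨e⟩⟩ := IsSimpleRing.exists_algEquiv_matrix_divisionRing_finite K A
  have : Finite D := Module.finite_of_finite K
  have hcomm : ∀ a b : D, a * b = b * a := (littleWedderburn D).mul_comm
  have hD : Function.Bijective (algebraMap K D) := by
    refine ⟨(algebraMap K D).injective, fun d => ?_⟩
    have hcen : ∀ a ∈ (A : Set (Matrix n n L)),
        Commute a (e.symm (Matrix.diagonal fun _ => d) : A) := by
      intro a ha
      have : Commute (⟨a, ha⟩ : A) (e.symm (Matrix.diagonal fun _ => d)) := by
        rw [← e.symm_apply_apply ⟨a, ha⟩]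
        refine Commute.map (f := e.symm) ?_
        ext i j
        simp [hcomm]
      exact congrArg Subtype.val this.eq
    obtain ⟨c, hc⟩ := Matrix.mem_range_scalar_of_commute_of_span_eq_top hspan hcen
    obtain ⟨k, rfl⟩ := Matrix.mem_range_of_smul_one_mem A hspan htr
      (hc ▸ (e.symm (Matrix.diagonal fun _ => d)).2)
    refine ⟨k, ?_⟩
    have h1 : e.symm (Matrix.diagonal fun _ => d) = algebraMap K A k := by
      refine Subtype.ext ?_
      rw [hc, algebraMap_smul, Algebra.smul_def, mul_one]
      rfl
    rw [AlgEquiv.symm_apply_eq, AlgEquiv.commutes] at h1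
    simpa [Matrix.algebraMap_matrix_apply] using (congr_fun₂ h1 0 0).symm
  let e' : A ≃ₐ[K] Matrix (Fin r) (Fin r) K :=
    e.trans (AlgEquiv.ofBijective (Algebra.ofId K D) hD).symm.mapMatrix
  have hrank : r * r = Fintype.card n * Fintype.card n := by
    have h1 := (Subalgebra.toSubmodule A).finrank_le_finrank_of_span_eq_top (L := L) hspan
    have h2 := Matrix.finrank_le_of_trace_mem A hspan htr
    have h3 := e'.toLinearEquiv.finrank_eq
    simp only [Module.finrank_matrix, Module.finrank_self, Fintype.card_fin, mul_one] at h1 h3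
    exact h3.symm.trans (le_antisymm h2 h1)
  have hr : Fintype.card n = Fintype.card (Fin r) := by
    rw [Fintype.card_fin]; exact (Nat.mul_self_inj.1 hrank).symm
  exact ⟨(Matrix.reindexAlgEquiv K K (Fintype.equivOfCardEq hr)).trans e'.symm⟩

end Descent

/-- A nondegenerate alternating form admits symplectic families of every admissible length. -/
theorem LinearMap.BilinForm.exists_symplectic_family {K V : Type*} [Field K] [AddCommGroup V]
    [Module K V] [FiniteDimensional K V] (B : LinearMap.BilinForm K V) (halt : B.IsAlt)
    (hnd : B.Nondegenerate) (k : ℕ) (hk : 2 * k ≤ Module.finrank K V) :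
    ∃ e f : ℕ → V, ∀ i < k, ∀ j < k,
      B (e i) (e j) = 0 ∧ B (f i) (f j) = 0 ∧ B (e i) (f j) = if i = j then 1 else 0 := by
  have hanti : ∀ x y, B y x = - B x y := fun x y => (halt.neg_eq x y).symm
  induction k with
  | zero => exact ⟨0, 0, by simp⟩
  | succ k ih =>
    obtain ⟨e, f, h⟩ := ih (by omega)
    obtain ⟨v, hv0, hv⟩ : ∃ v : V, v ≠ 0 ∧ ∀ i < k, B (e i) v = 0 ∧ B (f i) v = 0 := by
      let T : V →ₗ[K] (Fin k ⊕ Fin k → K) :=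
        LinearMap.pi (Sum.elim (fun i => B (e i)) (fun i => B (f i)))
      have hT : T.ker ≠ ⊥ := LinearMap.ker_ne_bot_of_finrank_lt (by simp; omega)
      obtain ⟨v, hvT, hv0⟩ := T.ker.ne_bot_iff.1 hT
      have hvT' : ∀ x, T v x = 0 := fun x => by rw [show T v = 0 from hvT]; rfl
      exact ⟨v, hv0, fun i hi => ⟨hvT' (Sum.inl ⟨i, hi⟩), hvT' (Sum.inr ⟨i, hi⟩)⟩⟩
    obtain ⟨u, hu⟩ : ∃ u, B v u ≠ 0 := by
      by_contra! hu
      exact hv0 (hnd.1 v hu)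
    let w₀ := (B v u)⁻¹ • u
    let w := w₀ - ∑ i ∈ Finset.range k, (B (e i) w₀ • f i - B (f i) w₀ • e i)
    have hve : ∀ i < k, B v (e i) = 0 ∧ B v (f i) = 0 := fun i hi => by
      rw [hanti (e i), hanti (f i), (hv i hi).1, (hv i hi).2]; simp
    have hvw : B v w = 1 := by
      have hs : ∑ i ∈ Finset.range k, B v (B (e i) w₀ • f i - B (f i) w₀ • e i) = 0 :=
        Finset.sum_eq_zero fun i hi => by simp [hve i (Finset.mem_range.1 hi)]
      simp only [w, map_sub, map_sum] at hs ⊢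
      rw [hs]
      simp [w₀, hu]
    have hew : ∀ j < k, B (e j) w = 0 ∧ B (f j) w = 0 := fun j hj => by
      have h1 : ∑ i ∈ Finset.range k, B (e j) (B (e i) w₀ • f i - B (f i) w₀ • e i) =
          B (e j) w₀ := by
        rw [Finset.sum_eq_single_of_mem j (Finset.mem_range.2 hj)]
        · simp [h j hj j hj]
        · intro i hi hij
          simp [h j hj i (Finset.mem_range.1 hi), hij.symm]
      have h2 : ∑ i ∈ Finset.range k, B (f j) (B (e i) w₀ • f i - B (f i) w₀ • e i) =
          B (f j) w₀ := by
        rw [Finset.sum_eq_single_of_mem j (Finset.mem_range.2 hj)]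
        · simp [h j hj j hj, hanti (e j) (f j)]
        · intro i hi hij
          have := h i (Finset.mem_range.1 hi) j hj
          simp [h j hj i (Finset.mem_range.1 hi), hanti (e i) (f j), this, hij]
      simp only [w, map_sub, map_sum] at h1 h2 ⊢
      rw [h1, h2]
      simp
    refine ⟨Function.update e k v, Function.update f k w, fun i hi j hj => ?_⟩
    rcases (Nat.lt_succ_iff_lt_or_eq.1 hi) with hi' | rfl <;>
      rcases (Nat.lt_succ_iff_lt_or_eq.1 hj) with hj' | rfl
    · simpa [hi'.ne, hj'.ne] using h i hi' j hj'
    · simp [hi'.ne, hv i hi', hew i hi']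
    · have := hanti (f j) w
      simp [hj'.ne, hj'.ne', hve j hj', this, hew j hj']
    · simp [hvw, halt v, halt w]

theorem MatAbsIrred.span_range_eq_top {G L : Type*} [Group G] [Field L] {n : ℕ} [NeZero n]
    (ρ : G →* Matrix (Fin n) (Fin n) L) (hirr : MatAbsIrred n L (fun g => ρ g)) :
    Submodule.span L (Set.range ρ) = ⊤ := by
  let F := AlgebraicClosure L
  let ι : Matrix (Fin n) (Fin n) L →ₐ[L] Matrix (Fin n) (Fin n) F :=
    (Algebra.ofId L F).mapMatrix
  let ρF : G →* Matrix (Fin n) (Fin n) F := (ι : _ →* _).comp ρ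
  have htop : Algebra.adjoin F (Set.range ρF) = ⊤ := by
    have h := Subalgebra.eq_top_of_irreducible (V := Fin n → F)
      ((Algebra.adjoin F (Set.range ρF)).map (Matrix.toLinAlgEquiv' : _ ≃ₐ[F] _).toAlgHom)
      fun W hW => hirr W fun g w hw =>
        hW _ ⟨ρF g, Algebra.subset_adjoin ⟨g, rfl⟩, rfl⟩ w hw
    rw [eq_top_iff]
    intro X _
    obtain ⟨Y, hY, hYX⟩ : Matrix.toLinAlgEquiv' X ∈
      (Algebra.adjoin F (Set.range ρF)).map (Matrix.toLinAlgEquiv' : _ ≃ₐ[F] _).toAlgHom :=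
      h ▸ trivial
    exact (Matrix.toLinAlgEquiv'.injective hYX) ▸ hY
  have hspan : Submodule.span F (Set.range ρF) = ⊤ := by
    have h := Algebra.adjoin_eq_span F (Set.range ρF)
    rw [← MonoidHom.coe_mrange, Submonoid.closure_eq, MonoidHom.coe_mrange, htop] at h
    simpa using h.symm
  let W := (Submodule.span L (Set.range ρ)).map ι.toLinearMap
  have hW : Submodule.span F (W : Set (Matrix (Fin n) (Fin n) F)) = ⊤ := by
    rw [eq_top_iff, ← hspan]
    refine Submodule.span_mono ?_
    rintro _ ⟨g, rfl⟩
    exact ⟨ρ g, Submodule.subset_span ⟨g, rfl⟩, rfl⟩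
  refine Submodule.eq_top_of_finrank_eq (le_antisymm (Submodule.finrank_le _) ?_)
  have h1 := W.finrank_le_finrank_of_span_eq_top (L := F) hW
  have h2 : Module.finrank L W ≤ _ := Submodule.finrank_map_le ι.toLinearMap _
  simp only [Module.finrank_matrix, Module.finrank_self] at h1 ⊢
  exact h1.trans h2

/-- A representation whose image spans the full matrix algebra over a finite field `L`, with traces
in a subfield, can be conjugated into the matrices over that subfield. -/
theorem MonoidHom.exists_isUnit_conj_mem_of_trace_mem {G K L n : Type*} [Group G] [Field K]
    [Field L] [Algebra K L] [Finite L] [Fintype n] [DecidableEq n] [Nonempty n]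
    (ρ : G →* Matrix n n L) (hspan : Submodule.span L (Set.range ρ) = ⊤)
    (htr : ∀ g, (ρ g).trace ∈ (algebraMap K L).range) :
    ∃ M : Matrix n n L, IsUnit M ∧ ∃ b : G → Matrix n n K,
      ∀ g, ρ g * M = M * (b g).map (algebraMap K L) := by
  let A := Algebra.adjoin K (Set.range ρ)
  have hA : Subalgebra.toSubmodule A = Submodule.span K (Set.range ρ) := by
    rw [Algebra.adjoin_eq_span, ← MonoidHom.coe_mrange, Submonoid.closure_eq]
  have hAspan : Submodule.span L (A : Set (Matrix n n L)) = ⊤ :=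
    eq_top_iff.2 (hspan ▸ Submodule.span_mono Algebra.subset_adjoin)
  have hAtr : ∀ a ∈ A, a.trace ∈ (algebraMap K L).range := fun a ha => by
    have ha' : a ∈ Submodule.span K (Set.range ρ) := hA ▸ ha
    induction ha' using Submodule.span_induction with
    | mem x hx => obtain ⟨g, rfl⟩ := hx; exact htr g
    | zero => simp
    | add x y hx hy h₁ h₂ =>
      rw [Matrix.trace_add]
      rw [← hA] at hx hy
      exact add_mem (h₁ hx) (h₂ hy)
    | smul c x hx h =>
      rw [Matrix.trace_smul, Algebra.smul_def]
      rw [← hA] at hx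
      exact mul_mem ⟨c, rfl⟩ (h hx)
  obtain ⟨e⟩ := Matrix.exists_algEquiv_of_trace_mem A hAspan hAtr
  obtain ⟨M, hM, h⟩ := Matrix.exists_isUnit_intertwining (A.val.comp e.toAlgHom)
  refine ⟨M, hM, fun g => e.symm ⟨ρ g, Algebra.subset_adjoin ⟨g, rfl⟩⟩, fun g => ?_⟩
  rw [← h]
  simp

theorem stdJ_apply_self {n : ℕ} (hn : 2 ≤ n) (R : Type*) [CommRing R] (i : Fin n) :
    stdJ n R i i = 0 := by
  have : i.val + n / 2 ≠ i.val := by omega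
  simp only [stdJ, Matrix.of_apply, if_neg this]

theorem stdJ_transpose {n : ℕ} (hn : 2 ≤ n) (R : Type*) [CommRing R] :
    (stdJ n R)ᵀ = -stdJ n R := by
  ext i j
  simp only [stdJ, Matrix.transpose_apply, Matrix.of_apply, Matrix.neg_apply]
  split_ifs <;> first | omega | simp

theorem isUnit_stdJ {n : ℕ} (hn : Even n) (R : Type*) [CommRing R] : IsUnit (stdJ n R) := by
  obtain ⟨m, rfl⟩ := hn
  have h : (stdJ (m + m) R).submatrix finSumFinEquiv finSumFinEquiv = -Matrix.J (Fin m) R := by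
    have hm : (m + m) / 2 = m := by omega
    ext i j
    rcases i with i | i <;> rcases j with j | j <;>
      simp [stdJ, Matrix.J, hm, Matrix.one_apply, Fin.ext_iff] <;> grind
  rw [Matrix.isUnit_iff_isUnit_det, ← Matrix.det_submatrix_equiv_self finSumFinEquiv, h,
    Matrix.det_neg]
  exact (isUnit_one.neg.pow _).mul (Matrix.isUnit_det_J _ _)

theorem stdJ_map {R S : Type*} [CommRing R] [CommRing S] (n : ℕ) (f : R →+* S) :
    (stdJ n R).map f = stdJ n S := by
  ext i j
  simp only [stdJ, Matrix.map_apply, Matrix.of_apply]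
  split_ifs <;> simp

theorem Matrix.dotProduct_mulVec_self_eq_zero {n R : Type*} [Fintype n] [CommRing R]
    {P : Matrix n n R} (hPt : Pᵀ = -P) (hPd : ∀ i, P i i = 0) (x : n → R) :
    x ⬝ᵥ P *ᵥ x = 0 := by
  simp only [dotProduct, Matrix.mulVec, Finset.mul_sum]
  rw [← Finset.sum_product']
  refine Finset.sum_involution (fun p _ => (p.2, p.1)) ?_ ?_ (by simp) (by simp)
  · rintro ⟨i, j⟩ _
    have : P j i = -P i j := congr_fun₂ hPt i j
    simp only [this]
    ring
  · rintro ⟨i, j⟩ _ h heq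
    obtain rfl : j = i := congrArg Prod.fst heq
    simp [hPd] at h

/-- Every nondegenerate alternating matrix is congruent to the standard one. -/
theorem Matrix.exists_transpose_mul_mul_eq_stdJ {K : Type*} [Field K] {n : ℕ} (hn2 : 2 ≤ n)
    (hn : Even n) {P : Matrix (Fin n) (Fin n) K} (hP : IsUnit P) (hPt : Pᵀ = -P)
    (hPd : ∀ i, P i i = 0) :
    ∃ N : Matrix (Fin n) (Fin n) K, IsUnit N ∧ Nᵀ * P * N = stdJ n K := by
  let B : LinearMap.BilinForm K (Fin n → K) := Matrix.toBilin' P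
  have hanti : ∀ x y, B x y = -B y x := fun x y => by
    simp only [B, Matrix.toBilin'_apply']
    rw [Matrix.dotProduct_mulVec, ← Matrix.mulVec_transpose, hPt, Matrix.neg_mulVec,
      neg_dotProduct, dotProduct_comm]
  have halt : B.IsAlt := fun x => by
    simpa only [B, Matrix.toBilin'_apply'] using
      Matrix.dotProduct_mulVec_self_eq_zero hPt hPd x
  have hnd : B.Nondegenerate :=
    LinearMap.BilinForm.nondegenerate_toBilin'_of_det_ne_zero' P
      ((Matrix.isUnit_iff_isUnit_det _).1 hP).ne_zero
  obtain ⟨e, f, hef⟩ := B.exists_symplectic_family halt hnd (n / 2) (by simp; omega)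
  let c : Fin n → Fin n → K := fun j => if j.val < n / 2 then e j else f (j.val - n / 2)
  have hN : (Matrix.of c) * P * (Matrix.of c)ᵀ = stdJ n K := by
    ext i j
    have h1 : ((Matrix.of c) * P * (Matrix.of c)ᵀ) i j = B (c i) (c j) := by
      simp only [B, Matrix.toBilin'_apply', Matrix.dotProduct_mulVec]
      rfl
    rw [h1]
    simp only [c, stdJ, Matrix.of_apply]
    have hi := i.2
    have hj := j.2
    have hn' : n / 2 + n / 2 = n := by obtain ⟨m, rfl⟩ := hn; omega
    by_cases h2 : i.val < n / 2 <;> by_cases h3 : j.val < n / 2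
    · have := hef i h2 j h3
      grind
    · have := hef i h2 (j.val - n / 2) (by omega)
      grind
    · have := hef j h3 (i.val - n / 2) (by omega)
      have := hanti (e j) (f (i.val - n / 2))
      grind
    · have := hef (i.val - n / 2) (by omega) (j.val - n / 2) (by omega)
      grind
  refine ⟨(Matrix.of c)ᵀ, ?_, by rwa [Matrix.transpose_transpose]⟩
  have h := isUnit_stdJ hn K
  rw [← hN, Matrix.isUnit_iff_isUnit_det, Matrix.det_mul] at h
  exact (Matrix.isUnit_iff_isUnit_det _).2 (isUnit_of_mul_isUnit_right h)

/-- A similitude group which acts by matrices over a subfield with multipliers in this subfield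
preserves, up to a factor, a form defined over the subfield. -/
theorem Matrix.exists_linearMap_map_eq_smul {G K L n : Type*} [Field K] [Field L] [Algebra K L]
    [Fintype n] [DecidableEq n] [Nonempty n] {P : Matrix n n L} (hP : IsUnit P)
    (b : G → Matrix n n K) (α : G → K)
    (hb : Submodule.span L (Set.range fun g => (b g).map (algebraMap K L)) = ⊤)
    (hunit : ∀ g, IsUnit ((b g).map (algebraMap K L)))
    (hPb : ∀ g, ((b g).map (algebraMap K L))ᵀ * P * (b g).map (algebraMap K L) =
      algebraMap K L (α g) • P) :
    ∃ (f : L →ₗ[K] K) (l : L), l ≠ 0 ∧ (P.map f).map (algebraMap K L) = l • P := by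
  obtain ⟨i, j, hij⟩ : ∃ i j, P i j ≠ 0 := by
    by_contra! h
    exact hP.ne_zero (Matrix.ext h)
  obtain ⟨f, hf⟩ : ∃ f : Module.Dual K L, f (P i j) ≠ 0 := by
    by_contra! h
    exact hij ((Module.forall_dual_apply_eq_zero_iff K _).1 h)
  set Q := (P.map f).map (algebraMap K L) with hQ
  have hQb : ∀ g, ((b g).map (algebraMap K L))ᵀ * Q * (b g).map (algebraMap K L) =
      algebraMap K L (α g) • Q := fun g => by
    have h1 : (b g)ᵀ * P.map f * b g = α g • P.map f := by
      ext x y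
      have := congrArg f (congr_fun₂ (hPb g) x y)
      simp only [Matrix.mul_apply, Matrix.smul_apply, Matrix.map_apply, Matrix.transpose_apply,
        smul_eq_mul, Finset.sum_mul, map_sum] at this ⊢
      rw [← smul_eq_mul (algebraMap K L _), algebraMap_smul, map_smul, smul_eq_mul] at this
      rw [← this]
      refine Finset.sum_congr rfl fun s _ => Finset.sum_congr rfl fun t _ => ?_
      have hst : algebraMap K L (b g t x) * P t s * algebraMap K L (b g s y) =
          (b g t x * b g s y) • P t s := by
        rw [Algebra.smul_def, map_mul]
        ring
      rw [hst, map_smul, smul_eq_mul]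
      ring
    have h2 := congrArg (fun X : Matrix n n K => X.map (algebraMap K L)) h1
    simpa [Matrix.map_mul, Matrix.transpose_map, hQ, Matrix.map_smul'] using h2
  have hPinv : P⁻¹ * P = 1 := Matrix.nonsing_inv_mul _ ((Matrix.isUnit_iff_isUnit_det _).1 hP)
  have hPinv' : P * P⁻¹ = 1 := Matrix.mul_nonsing_inv _ ((Matrix.isUnit_iff_isUnit_det _).1 hP)
  obtain ⟨l, hl⟩ := Matrix.mem_range_scalar_of_commute_of_span_eq_top hb (X := P⁻¹ * Q) (by
    rintro _ ⟨g, rfl⟩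
    have hP' := hPb g
    have hQ' := hQb g
    have hu := hunit g
    simp only
    generalize (b g).map (algebraMap K L) = β at hP' hQ' hu ⊢
    have hα : algebraMap K L (α g) ≠ 0 := by
      intro h0
      rw [h0, zero_smul] at hP'
      exact (((Matrix.isUnit_transpose _).2 hu).mul hP |>.mul hu).ne_zero hP'
    refine (((Matrix.isUnit_transpose β).2 hu).mul hP).mul_left_cancel ?_
    calc βᵀ * P * (β * (P⁻¹ * Q)) = (βᵀ * P * β) * (P⁻¹ * Q) := by noncomm_ring
      _ = algebraMap K L (α g) • ((P * P⁻¹) * Q) := by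
        rw [hP', smul_mul_assoc, ← mul_assoc]
      _ = βᵀ * (P * P⁻¹) * Q * β := by rw [hPinv', one_mul, mul_one, hQ']
      _ = βᵀ * P * (P⁻¹ * Q * β) := by noncomm_ring)
  have hQP : Q = l • P := by
    rw [← one_mul Q, ← hPinv', mul_assoc, hl, mul_smul_comm, mul_one]
  refine ⟨f, l, ?_, hQP⟩
  rintro rfl
  have := congr_fun₂ hQP i j
  simp [hQ, hf] at this

/-- An absolutely irreducible symplectic representation over a finite field `L`
without complex multiplication whose traces and multipliers lie in a subfield `K̃`
can be conjugated, by a matrix of `GSp_n(L)`, into `GSp_n(K̃)`. -/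
theorem symp_rep_defined_over_subfield
    {G : Type*} [Group G] {L : Type*} [Field L] [Fintype L] (K' : Subfield L)
    {n : ℕ} (hn2 : 2 ≤ n) (hneven : Even n)
    (ρ : G →* Matrix (Fin n) (Fin n) L)
    (hρGSp : ∀ g, IsGSp n L (ρ g))
    (hirr : MatAbsIrred n L (fun g => ρ g))
    (hnocm : NoCM n L ρ)
    (htr : ∀ g, (ρ g).trace ∈ K')
    (hmult : ∀ g, ∃ α : Lˣ, (α : L) ∈ K' ∧
      (ρ g)ᵀ * stdJ n L * ρ g = (α : L) • stdJ n L) :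
    ∃ M : Matrix (Fin n) (Fin n) L, IsGSp n L M ∧
      ∀ g, (∀ i j, (M⁻¹ * ρ g * M) i j ∈ K') ∧
        ∃ α : Lˣ, (α : L) ∈ K' ∧
          (M⁻¹ * ρ g * M)ᵀ * stdJ n L * (M⁻¹ * ρ g * M) = (α : L) • stdJ n L := by
  have : NeZero n := ⟨by omega⟩
  have hspan := MatAbsIrred.span_range_eq_top ρ hirr
  obtain ⟨M, hM, b, hb⟩ := ρ.exists_isUnit_conj_mem_of_trace_mem (K := K') hspan
    fun g => ⟨⟨_, htr g⟩, rfl⟩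
  choose α hα hαJ using hmult
  have hMdet := (Matrix.isUnit_iff_isUnit_det M).1 hM
  have hρ : ∀ g, IsUnit (ρ g) := fun g => (hρGSp g).1
  have hβ : ∀ g, (b g).map (algebraMap K' L) = M⁻¹ * (ρ g * M) := fun g => by
    rw [hb, Matrix.nonsing_inv_mul_cancel_left _ _ hMdet]
  have hMinv : IsUnit M⁻¹ := (Matrix.isUnit_nonsing_inv_iff).2 hM
  have hβspan : Submodule.span L (Set.range fun g => (b g).map (algebraMap K' L)) = ⊤ := by
    let c := (LinearMap.mulLeft L M⁻¹).comp (LinearMap.mulRight L M)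
    have hc : (Set.range fun g => (b g).map (algebraMap K' L)) = c '' Set.range ρ := by
      rw [← Set.range_comp]
      exact congrArg Set.range (funext hβ)
    rw [hc, ← Submodule.map_span, hspan, Submodule.map_top, LinearMap.range_eq_top]
    refine fun Y => ⟨M * Y * M⁻¹, ?_⟩
    simp only [c, LinearMap.comp_apply, LinearMap.mulLeft_apply, LinearMap.mulRight_apply]
    rw [Matrix.nonsing_inv_mul_cancel_right _ _ hMdet,
      Matrix.nonsing_inv_mul_cancel_left _ _ hMdet]
  set J := stdJ n L with hJ
  set P := Mᵀ * J * M with hPdef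
  have hP : IsUnit P := (((Matrix.isUnit_transpose M).2 hM).mul (isUnit_stdJ hneven L)).mul hM
  have hPt : Pᵀ = -P := by
    simp [hPdef, hJ, Matrix.transpose_mul, stdJ_transpose hn2, mul_assoc]
  have hPd : ∀ i, P i i = 0 := fun i => by
    have h := Matrix.dotProduct_mulVec_self_eq_zero (stdJ_transpose hn2 L)
      (stdJ_apply_self hn2 L) (Mᵀ i)
    rw [Matrix.dotProduct_mulVec] at h
    exact h
  obtain ⟨f, l, hl, hR⟩ := Matrix.exists_linearMap_map_eq_smul hP b (fun g => ⟨α g, hα g⟩) hβspan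
    (fun g => hβ g ▸ hMinv.mul ((hρ g).mul hM)) fun g => by
      calc ((b g).map (algebraMap K' L))ᵀ * P * (b g).map (algebraMap K' L)
          = (M * (b g).map (algebraMap K' L))ᵀ * J * (M * (b g).map (algebraMap K' L)) := by
            simp only [hPdef, Matrix.transpose_mul, mul_assoc]
        _ = Mᵀ * ((ρ g)ᵀ * J * ρ g) * M := by
            rw [← hb]; simp only [Matrix.transpose_mul, mul_assoc]
        _ = (α g : L) • P := by
            rw [hαJ, mul_smul_comm, smul_mul_assoc]
  have hRunit : IsUnit (P.map f) := by
    rw [Matrix.isUnit_iff_isUnit_det, isUnit_iff_ne_zero]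
    intro h0
    have h1 : ((P.map f).map (algebraMap K' L)).det = 0 := by
      rw [← RingHom.mapMatrix_apply, ← RingHom.map_det, h0, map_zero]
    rw [hR, Matrix.det_smul] at h1
    exact mul_ne_zero (pow_ne_zero _ hl) ((Matrix.isUnit_iff_isUnit_det _).1 hP).ne_zero h1
  obtain ⟨N, hN, hNJ⟩ := Matrix.exists_transpose_mul_mul_eq_stdJ hn2 hneven hRunit
    (by
      ext i j
      have : P j i = -P i j := congr_fun₂ hPt i j
      simp [this])
    (fun i => by simp [hPd])
  set ν := N.map (algebraMap K' L) with hν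
  have hNdet := (Matrix.isUnit_iff_isUnit_det N).1 hN
  have hνunit : IsUnit ν := hN.map (algebraMap K' L).mapMatrix
  have hMν : IsUnit (M * ν) := hM.mul hνunit
  have hMνdet := (Matrix.isUnit_iff_isUnit_det _).1 hMν
  have hform' : J = l • ((M * ν)ᵀ * J * (M * ν)) := by
    have h := congrArg (fun X : Matrix (Fin n) (Fin n) K' => X.map (algebraMap K' L)) hNJ
    simp only [Matrix.map_mul, stdJ_map, hR] at h
    rw [mul_smul_comm, smul_mul_assoc] at h
    refine h.symm.trans ?_
    simp only [hPdef, hν, Matrix.transpose_mul, mul_assoc, Matrix.transpose_map]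
  have hform : (M * ν)ᵀ * J * (M * ν) = l⁻¹ • J := by
    conv_rhs => rw [hform']
    rw [inv_smul_smul₀ hl]
  refine ⟨M * ν, ⟨hMν, (Units.mk0 l hl)⁻¹, by simpa using hform⟩, fun g => ⟨fun i j => ?_,
    α g, hα g, ?_⟩⟩
  · have h : (M * ν)⁻¹ * ρ g * (M * ν) = (N⁻¹ * b g * N).map (algebraMap K' L) := by
      refine hMν.mul_left_cancel ?_
      rw [mul_assoc _ (ρ g), Matrix.mul_nonsing_inv_cancel_left _ _ hMνdet, mul_assoc M ν, hν,
        ← Matrix.map_mul, mul_assoc N⁻¹, Matrix.mul_nonsing_inv_cancel_left _ _ hNdet,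
        Matrix.map_mul, ← mul_assoc, ← mul_assoc, hb]
    rw [h]
    exact ((N⁻¹ * b g * N) i j).2
  · set X := M * ν with hX
    have hXX : X * (X⁻¹ * ρ g * X) = ρ g * X := by
      rw [mul_assoc X⁻¹, Matrix.mul_nonsing_inv_cancel_left _ _ hMνdet]
    calc (X⁻¹ * ρ g * X)ᵀ * J * (X⁻¹ * ρ g * X)
        = l • ((X * (X⁻¹ * ρ g * X))ᵀ * J * (X * (X⁻¹ * ρ g * X))) := by
          conv_lhs => rw [hform']
          rw [mul_smul_comm, smul_mul_assoc]
          simp only [Matrix.transpose_mul, mul_assoc]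
      _ = l • (Xᵀ * ((ρ g)ᵀ * J * ρ g) * X) := by
          rw [hXX]; simp only [Matrix.transpose_mul, mul_assoc]
      _ = (α g : L) • J := by
          rw [hαJ, mul_smul_comm, smul_mul_assoc, hform, smul_comm, smul_inv_smul₀ hl]
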